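/- Assume α − 2 < β < α. There exists λ0 > 0 such that for every λ ≥ λ0 there exist constants C3, C4 > 0 with C3 / (1 + |x|^{α−β}) ≤ 𝒱_λ(x) ≤ C4 / (1 + |x|^{α−β}) for all x ∈ ℝ^N. -/

import Mathlib

open Real

/-- The potential `𝒱_λ` associated with the operator `A`. -/
noncomputable def pot (N : ℕ) (α β b c lam : ℝ) (x : EuclideanSpace ℝ (Fin N)) : ℝ :=
  (b ^ 2 / 4 - b * α / 2) * ‖x‖ ^ (2 * α - 2) / (1 + ‖x‖ ^ α) ^ 2
    + (b / 2) * ((N : ℝ) + α - 2) * ‖x‖ ^ (α - 2) / (1 + ‖x‖ ^ α)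
    + (c * ‖x‖ ^ β + lam) / (1 + ‖x‖ ^ α)

lemma rpow_le_one_add (r p q : ℝ) (hr : 0 ≤ r) (hp : 0 < p) (hpq : p ≤ q) :
    r ^ p ≤ 1 + r ^ q := by
  have hq : 0 ≤ r ^ q := rpow_nonneg hr q
  rcases le_total r 1 with h | h
  · have := rpow_le_one hr h hp.le
    linarith
  · have := rpow_le_rpow_of_exponent_le h hpq
    linarith

lemma absorb (p q K e : ℝ) (hp : 0 < p) (hpq : p < q) (hK : 0 ≤ K) (he : 0 < e) :
    ∃ M : ℝ, 0 ≤ M ∧ ∀ r : ℝ, 0 ≤ r → K * r ^ p ≤ e * r ^ q + M := by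
  have hB : 0 < K / e + 1 := by positivity
  have hd : 0 < q - p := by linarith
  set R : ℝ := (K / e + 1) ^ (1 / (q - p)) with hR
  have hR0 : 0 < R := rpow_pos_of_pos hB _
  refine ⟨K * R ^ p, by positivity, fun r hr => ?_⟩
  rcases le_total r R with h | h
  · have h1 : r ^ p ≤ R ^ p := rpow_le_rpow hr h hp.le
    have h2 : K * r ^ p ≤ K * R ^ p := mul_le_mul_of_nonneg_left h1 hK
    have h3 : 0 ≤ e * r ^ q := by positivity
    linarith
  · have hr0 : 0 < r := lt_of_lt_of_le hR0 h
    have h1 : R ^ (q - p) ≤ r ^ (q - p) := rpow_le_rpow hR0.le h hd.le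
    have h2 : R ^ (q - p) = K / e + 1 := by
      rw [hR, ← rpow_mul hB.le, one_div_mul_cancel hd.ne', rpow_one]
    have h3 : r ^ q = r ^ (q - p) * r ^ p := by
      rw [← rpow_add hr0]; congr 1; ring
    have h4 : K ≤ e * r ^ (q - p) := by
      have : K / e ≤ r ^ (q - p) := by linarith
      rw [div_le_iff₀ he] at this
      linarith
    have h5 : 0 ≤ r ^ p := rpow_nonneg hr p
    have h6 : 0 ≤ K * R ^ p := by positivity
    rw [h3]
    nlinarith

/-- Assume `α - 2 < β < α`. There exists `λ0 > 0` such that for every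
`λ ≥ λ0` there are constants `C3, C4 > 0` with
`C3 / (1 + |x|^{α-β}) ≤ 𝒱_λ(x) ≤ C4 / (1 + |x|^{α-β})` for all `x ∈ ℝ^N`. -/
theorem stmt15 (N : ℕ) (hN : 2 < N) (α β b c : ℝ) (hα : 2 < α) (hc : 0 < c)
    (hβ1 : α - 2 < β) (hβ2 : β < α) :
    ∃ lam0 : ℝ, 0 < lam0 ∧ ∀ lam : ℝ, lam0 ≤ lam →
      ∃ C3 C4 : ℝ, 0 < C3 ∧ 0 < C4 ∧ ∀ x : EuclideanSpace ℝ (Fin N),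
        C3 / (1 + ‖x‖ ^ (α - β)) ≤ pot N α β b c lam x ∧
        pot N α β b c lam x ≤ C4 / (1 + ‖x‖ ^ (α - β)) := by
  set A : ℝ := b ^ 2 / 4 - b * α / 2 with hA
  set B : ℝ := (b / 2) * ((N : ℝ) + α - 2) with hB
  obtain ⟨M, hM, hab⟩ := absorb (α - 2) β (|A| + |B|) (c / 2) (by linarith) hβ1
    (by positivity) (by positivity)
  refine ⟨M + 1, by linarith, fun lam hlam => ?_⟩
  refine ⟨min (c / 2) 1, 3 * (3 * c / 2 + lam + M), lt_min (by linarith) one_pos,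
    by linarith, fun x => ?_⟩
  have hr : 0 ≤ ‖x‖ := norm_nonneg x
  unfold pot
  rw [← hA, ← hB]
  generalize ‖x‖ = r at hr
  have hu : 0 ≤ r ^ α := rpow_nonneg hr _
  have hv : 0 ≤ r ^ β := rpow_nonneg hr _
  have hw : 0 ≤ r ^ (α - β) := rpow_nonneg hr _
  have ht : 0 ≤ r ^ (α - 2) := rpow_nonneg hr _
  have e1 : r ^ (2 * α - 2) = r ^ (α - 2) * r ^ α := by
    rw [← rpow_add_of_nonneg hr (by linarith) (by linarith)]; congr 1; ring
  have e2 : r ^ α = r ^ β * r ^ (α - β) := by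
    rw [← rpow_add_of_nonneg hr (by linarith) (by linarith)]; congr 1; ring
  have hvu : r ^ β ≤ 1 + r ^ α := rpow_le_one_add r β α hr (by linarith) hβ2.le
  have hwu : r ^ (α - β) ≤ 1 + r ^ α :=
    rpow_le_one_add r (α - β) α hr (by linarith) (by linarith)
  have hab := hab r hr
  rw [e1]
  generalize r ^ α = u at *
  generalize r ^ β = v at *
  generalize r ^ (α - β) = w at *
  generalize r ^ (α - 2) = t at *
  have hD : 0 < 1 + u := by linarith
  have hW : 0 < 1 + w := by linarith
  have hs0 : 0 ≤ u / (1 + u) := by positivity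
  have hs1 : u / (1 + u) ≤ 1 := by rw [div_le_one hD]; linarith
  have e3 : A * (t * u) / (1 + u) ^ 2 + B * t / (1 + u) + (c * v + lam) / (1 + u)
      = (A * (u / (1 + u)) * t + B * t + c * v + lam) / (1 + u) := by
    field_simp
    ring
  rw [e3]
  generalize u / (1 + u) = s at *
  have hAs : |A * s| ≤ |A| := by
    rw [abs_mul, abs_of_nonneg hs0]
    exact mul_le_of_le_one_right (abs_nonneg A) hs1
  have hz : |A * s * t + B * t| ≤ (|A| + |B|) * t := by
    have : A * s * t + B * t = (A * s + B) * t := by ring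
    rw [this, abs_mul, abs_of_nonneg ht]
    refine mul_le_mul_of_nonneg_right ?_ ht
    linarith [abs_add_le (A * s) B]
  obtain ⟨hz1, hz2⟩ := abs_le.mp hz
  have hlow : min (c / 2) 1 * (1 + v) ≤ A * s * t + B * t + c * v + lam := by
    have h1 : min (c / 2) 1 ≤ 1 := min_le_right _ _
    have h2 : min (c / 2) 1 * v ≤ c / 2 * v :=
      mul_le_mul_of_nonneg_right (min_le_left _ _) hv
    linarith
  have hup : A * s * t + B * t + c * v + lam ≤ (3 * c / 2 + lam + M) * (1 + v) := by
    have h1 : 0 ≤ (lam + M) * v := mul_nonneg (by linarith) hv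
    linarith
  have hm : 0 < min (c / 2) 1 := lt_min (by linarith) one_pos
  have hP : 0 ≤ 3 * c / 2 + lam + M := by linarith
  have ex : (1 + v) * (1 + w) = 1 + u + v + w := by rw [e2]; ring
  constructor
  · rw [div_le_div_iff₀ hW hD]
    calc min (c / 2) 1 * (1 + u) ≤ min (c / 2) 1 * ((1 + v) * (1 + w)) :=
          mul_le_mul_of_nonneg_left (by linarith) hm.le
      _ = min (c / 2) 1 * (1 + v) * (1 + w) := by ring
      _ ≤ _ := mul_le_mul_of_nonneg_right hlow hW.le
  · rw [div_le_div_iff₀ hD hW]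
    calc _ ≤ (3 * c / 2 + lam + M) * (1 + v) * (1 + w) :=
          mul_le_mul_of_nonneg_right hup hW.le
      _ = (3 * c / 2 + lam + M) * ((1 + v) * (1 + w)) := by ring
      _ ≤ (3 * c / 2 + lam + M) * (3 * (1 + u)) :=
          mul_le_mul_of_nonneg_left (by linarith) hP
      _ = _ := by ring
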